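/- arXiv:2406.09473 — 6 statements merged into one kernel-verified Lean document; each statement's English description precedes it below -/
import Mathlib

section
/- Let Z be an n×k judge dummy matrix (entries in {0,1}, exactly one 1 per row, each judge j handling n_j ≥ 1 cases), let a partition of {1,…,n} into clusters be given, let D_n be the n×n diagonal matrix with (D_n)_{ii} = n_{J(i)}, and let X, y ∈ ℝⁿ. Define P_Z = Z(ZᵀZ)⁻¹Zᵀ, let P̈_Z be P_Z with all entries (i,j) such that i and j lie in the same cluster set to zero, and let L = (ZZᵀ − B_{ZZᵀ})X, where B_{ZZᵀ} is ZZᵀ with all entries outside the within-cluster positions set to zero. Then P̈_Z X = D_n⁻¹ L, P̈_Z is symmetric, and, provided XᵀD_n⁻¹L ≠ 0, the cluster-jackknife IV estimator satisfies (XᵀP̈_Z X)⁻¹ XᵀP̈_Z y = (XᵀD_n⁻¹L)⁻¹ Lᵀ D_n⁻¹ y, i.e. the CJIVE equals a weighted two-stage least squares estimator with the leave-out instrument D_n⁻¹L. -/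
open Matrix Finset

/-- A diagonal matrix with nonzero entries is inverted entrywise. -/
theorem inv_diagonal_of_ne_zero {ι : Type*} [Fintype ι] [DecidableEq ι] (d : ι → ℝ)
    (hd : ∀ i, d i ≠ 0) : (diagonal d)⁻¹ = diagonal fun i => (d i)⁻¹ :=
  inv_eq_right_inv <| by simp [diagonal_mul_diagonal, hd]

/-- Two rows of a judge dummy matrix have inner product one or zero according to whether they
share a judge. -/
theorem judgeDummy_mul_transpose_apply {ι κ : Type*} [Fintype κ] [DecidableEq κ]
    (Z : Matrix ι κ ℝ) (J : ι → κ) (hZ : ∀ i j, Z i j = if j = J i then 1 else 0) (i j : ι) :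
    (Z * Zᵀ) i j = if J i = J j then 1 else 0 := by
  simp [mul_apply, hZ, eq_comm (a := J j)]

/-- The Gram matrix of a judge dummy matrix is the diagonal matrix of caseloads. -/
theorem judgeDummy_transpose_mul {ι κ : Type*} [Fintype ι] [DecidableEq κ]
    (Z : Matrix ι κ ℝ) (J : ι → κ) (hZ : ∀ i j, Z i j = if j = J i then 1 else 0) :
    Zᵀ * Z = diagonal fun j => ((Finset.univ.filter fun i => J i = j).card : ℝ) := by
  ext a b
  by_cases hab : a = b
  · subst hab
    simp [mul_apply, hZ, ← ite_and, eq_comm (b := a)]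
  · rw [diagonal_apply_ne _ hab, mul_apply]
    refine Finset.sum_eq_zero fun i _ => ?_
    by_cases ha : a = J i
    · simp [hZ, ← ha, Ne.symm hab]
    · simp [hZ, ha]

/-- The entries of the projection onto the column space of a judge dummy matrix. -/
theorem judgeDummy_projection_apply {ι κ : Type*} [Fintype ι] [Fintype κ] [DecidableEq κ]
    (Z : Matrix ι κ ℝ) (J : ι → κ) (hZ : ∀ i j, Z i j = if j = J i then 1 else 0)
    (hpos : ∀ j, 1 ≤ (Finset.univ.filter fun i => J i = j).card) (i j : ι) :
    (Z * (Zᵀ * Z)⁻¹ * Zᵀ) i j =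
      if J i = J j then ((Finset.univ.filter fun l => J l = J i).card : ℝ)⁻¹ else 0 := by
  rw [judgeDummy_transpose_mul Z J hZ, inv_diagonal_of_ne_zero _ fun j =>
    Nat.cast_ne_zero.2 (Nat.one_le_iff_ne_zero.1 (hpos j)), mul_apply]
  by_cases h : J i = J j <;> simp [mul_diagonal, hZ, h, Ne.symm]

/-- For a judge dummy matrix `Z` and a clustering `C`, the cluster-jackknifed
projection matrix `P̈_Z` (within-cluster entries of `P_Z` set to zero) satisfies
`P̈_Z X = D_n⁻¹ L` with `L = (ZZᵀ − B_{ZZᵀ})X` the leave-out conviction count, `P̈_Z` is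
symmetric, and when `XᵀD_n⁻¹L ≠ 0` the CJIVE `(XᵀP̈_ZX)⁻¹XᵀP̈_Zy` equals the weighted
2SLS estimator `(XᵀD_n⁻¹L)⁻¹LᵀD_n⁻¹y` with leave-out instrument `D_n⁻¹L`. -/
theorem stmt1 (n k G : ℕ) (Z : Matrix (Fin n) (Fin k) ℝ) (J : Fin n → Fin k)
    (hZ : ∀ i j, Z i j = if j = J i then 1 else 0)
    (nj : Fin k → ℕ)
    (hnj : ∀ j, nj j = (Finset.univ.filter (fun i => J i = j)).card)
    (hpos : ∀ j, 1 ≤ nj j)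
    (C : Fin n → Fin G) (hC : Function.Surjective C)
    (X y : Fin n → ℝ) :
    let PZ : Matrix (Fin n) (Fin n) ℝ := Z * (Zᵀ * Z)⁻¹ * Zᵀ
    let Pdd : Matrix (Fin n) (Fin n) ℝ :=
      Matrix.of fun i j => if C i = C j then 0 else PZ i j
    let Dn : Matrix (Fin n) (Fin n) ℝ := Matrix.diagonal fun i => (nj (J i) : ℝ)
    let B : Matrix (Fin n) (Fin n) ℝ :=
      Matrix.of fun i j => if C i = C j then (Z * Zᵀ) i j else 0
    let L : Fin n → ℝ := (Z * Zᵀ - B) *ᵥ X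
    (Pdd *ᵥ X = Dn⁻¹ *ᵥ L) ∧ Pddᵀ = Pdd ∧
      (X ⬝ᵥ (Dn⁻¹ *ᵥ L) ≠ 0 →
        (X ⬝ᵥ (Pdd *ᵥ X))⁻¹ * (X ⬝ᵥ (Pdd *ᵥ y)) =
          (X ⬝ᵥ (Dn⁻¹ *ᵥ L))⁻¹ * (L ⬝ᵥ (Dn⁻¹ *ᵥ y))) := by
  intro PZ Pdd Dn B L
  have hJ : ∀ i, (nj (J i) : ℝ) ≠ 0 := fun i =>
    Nat.cast_ne_zero.2 (Nat.one_le_iff_ne_zero.1 (hpos _))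
  have hDn : Dn⁻¹ = diagonal fun i => (nj (J i) : ℝ)⁻¹ := inv_diagonal_of_ne_zero _ hJ
  have hPZ : ∀ i j, PZ i j = if J i = J j then (nj (J i) : ℝ)⁻¹ else 0 := by
    intro i j
    have h := judgeDummy_projection_apply Z J hZ (fun j => by
      rw [← hnj]; exact hpos j) i j
    simpa only [← hnj] using h
  have hleft : Pdd = Dn⁻¹ * (Z * Zᵀ - B) := by
    ext i j
    by_cases hc : C i = C j <;>
      simp [Pdd, B, hDn, hPZ, hc, judgeDummy_mul_transpose_apply Z J hZ]
  have hsymm : Pddᵀ = Pdd := by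
    ext i j
    by_cases hc : C i = C j
    · simp [Pdd, hc]
    · by_cases hj : J i = J j
      · simp [Pdd, hPZ, hc, hj, eq_comm]
      · simp [Pdd, hPZ, hc, hj, Ne.symm hc, Ne.symm hj]
  have hBsymm : (Z * Zᵀ - B)ᵀ = Z * Zᵀ - B := by
    ext i j
    simp only [B, transpose_apply, Matrix.sub_apply, of_apply,
      judgeDummy_mul_transpose_apply Z J hZ, eq_comm (a := J j), eq_comm (a := C j)]
  have hright : Pdd = (Z * Zᵀ - B) * Dn⁻¹ := by
    rw [← hsymm, hleft, transpose_mul, hBsymm, hDn, diagonal_transpose]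
  have hX : Pdd *ᵥ X = Dn⁻¹ *ᵥ L := by rw [hleft, ← mulVec_mulVec]
  refine ⟨hX, hsymm, fun _ => ?_⟩
  rw [hX, hright, ← mulVec_mulVec, dotProduct_mulVec X (Z * Zᵀ - B), ← mulVec_transpose, hBsymm]
end

section
/- Let Z be an n×k judge dummy matrix with projection matrix P_Z, let a partition of {1,…,n} into clusters [g], g = 1,…,G, be given, and let η, ε be random vectors in ℝⁿ with E|η_i ε_j| < ∞ for all i,j and E(η_i ε_j) = 0 whenever i and j lie in different clusters. Then E(ηᵀ P_Z ε) = Σ_{i=1}^n (1/n_{J(i)}) E(η_i ε_i) + Σ_{g=1}^G Σ_{i,j ∈ [g], i ≠ j} (1/n_{J(i)}) 1{J(i) = J(j)} E(η_i ε_j); that is, the many-instrument bias term decomposes into the own-observation term present under independence plus an additional term due to within-cluster dependence. -/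
open Matrix Finset MeasureTheory

/-- The Gram matrix of the dummy matrix of `J` is the diagonal matrix of the fiber sizes. -/
theorem dummy_gram {ι κ : Type*} [Fintype ι] [Fintype κ] [DecidableEq κ]
    (Z : Matrix ι κ ℝ) (J : ι → κ) (hZ : ∀ i j, Z i j = if j = J i then 1 else 0) :
    Zᵀ * Z = diagonal (fun j => ((Finset.univ.filter (fun i => J i = j)).card : ℝ)) := by
  ext a b
  simp only [mul_apply, transpose_apply, hZ, diagonal_apply]
  by_cases hab : a = b
  · subst hab
    simp [← ite_and, eq_comm]
  · rw [if_neg hab]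
    refine Finset.sum_eq_zero fun i _ => ?_
    by_cases ha : a = J i
    · have hb : b ≠ J i := fun hb => hab (ha.trans hb.symm)
      simp [hb]
    · simp [ha]

/-- The entries of the projection onto the column span of a dummy matrix. -/
theorem dummy_proj_apply {ι κ : Type*} [Fintype ι] [Fintype κ] [DecidableEq κ]
    (Z : Matrix ι κ ℝ) (J : ι → κ) (hZ : ∀ i j, Z i j = if j = J i then 1 else 0)
    (hpos : ∀ j, 1 ≤ (Finset.univ.filter (fun i => J i = j)).card) (i j : ι) :
    (Z * (Zᵀ * Z)⁻¹ * Zᵀ) i j =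
      (1 / ((Finset.univ.filter (fun l => J l = J i)).card : ℝ)) *
        (if J i = J j then 1 else 0) := by
  have hinv : (Zᵀ * Z)⁻¹ =
      diagonal (fun j => ((Finset.univ.filter (fun i => J i = j)).card : ℝ)⁻¹) := by
    rw [dummy_gram Z J hZ]
    refine inv_eq_right_inv ?_
    rw [diagonal_mul_diagonal, ← diagonal_one]
    congr 1
    funext a
    exact mul_inv_cancel₀ (Nat.cast_ne_zero.2 (Nat.one_le_iff_ne_zero.1 (hpos a)))
  rw [hinv, mul_apply]
  by_cases hij : J i = J j
  · simp [mul_diagonal, hZ, hij]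
  · simp [mul_diagonal, hZ, hij, Ne.symm hij]

/-- A double sum whose terms vanish across the fibers of `C` is its diagonal part plus the
off-diagonal part within each fiber. -/
theorem sum_sum_eq_diag_add_fiberwise {ι γ : Type*} [Fintype ι] [DecidableEq ι] [Fintype γ]
    [DecidableEq γ] (C : ι → γ) (f : ι → ι → ℝ) (hf : ∀ i j, C i ≠ C j → f i j = 0) :
    ∑ i, ∑ j, f i j = ∑ i, f i i + ∑ g, ∑ i ∈ Finset.univ.filter (fun i => C i = g),
      ∑ j ∈ Finset.univ.filter (fun j => C j = g ∧ j ≠ i), f i j := by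
  have hfib : ∑ g, ∑ i ∈ Finset.univ.filter (fun i => C i = g),
      ∑ j ∈ Finset.univ.filter (fun j => C j = g ∧ j ≠ i), f i j =
      ∑ i, ∑ j ∈ Finset.univ.filter (fun j => C j = C i ∧ j ≠ i), f i j := by
    rw [← Finset.sum_fiberwise Finset.univ C]
    refine Finset.sum_congr rfl fun g _ => Finset.sum_congr rfl fun i hi => ?_
    rw [(Finset.mem_filter.1 hi).2]
  rw [hfib, ← Finset.sum_add_distrib]
  refine Finset.sum_congr rfl fun i _ => ?_
  rw [← Finset.add_sum_erase _ _ (Finset.mem_univ i)]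
  congr 1
  symm
  refine Finset.sum_subset (fun j hj => by simp_all) fun j hj hj' => hf i j fun h => hj' ?_
  simp_all

/-- For a judge dummy matrix `Z` with projection `P_Z`, a clustering `C`,
and error vectors `η, ε` with integrable products whose cross-moments vanish across
clusters, the bias term `E(ηᵀP_Zε)` decomposes into the own-observation term plus the
within-cluster term. -/
theorem stmt2 {Ω : Type*} [MeasurableSpace Ω] (μ : Measure Ω) [IsProbabilityMeasure μ]
    (n k G : ℕ) (Z : Matrix (Fin n) (Fin k) ℝ) (J : Fin n → Fin k)
    (hZ : ∀ i j, Z i j = if j = J i then 1 else 0)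
    (nj : Fin k → ℕ)
    (hnj : ∀ j, nj j = (Finset.univ.filter (fun i => J i = j)).card)
    (hpos : ∀ j, 1 ≤ nj j)
    (C : Fin n → Fin G) (hC : Function.Surjective C)
    (η ε : Ω → Fin n → ℝ)
    (hint : ∀ i j, Integrable (fun ω => η ω i * ε ω j) μ)
    (hcross : ∀ i j, C i ≠ C j → (∫ ω, η ω i * ε ω j ∂μ) = 0) :
    (∫ ω, (η ω) ⬝ᵥ ((Z * (Zᵀ * Z)⁻¹ * Zᵀ) *ᵥ (ε ω)) ∂μ)
      = (∑ i, (1 / (nj (J i) : ℝ)) * ∫ ω, η ω i * ε ω i ∂μ)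
        + ∑ g, ∑ i ∈ Finset.univ.filter (fun i => C i = g),
            ∑ j ∈ Finset.univ.filter (fun j => C j = g ∧ j ≠ i),
              (1 / (nj (J i) : ℝ)) * (if J i = J j then 1 else 0)
                * ∫ ω, η ω i * ε ω j ∂μ := by
  obtain rfl : nj = fun j => (Finset.univ.filter (fun i => J i = j)).card := funext hnj
  have hexp : ∀ ω, (η ω) ⬝ᵥ ((Z * (Zᵀ * Z)⁻¹ * Zᵀ) *ᵥ (ε ω)) =
      ∑ i, ∑ j, (1 / ((Finset.univ.filter (fun l => J l = J i)).card : ℝ)) *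
        (if J i = J j then 1 else 0) * (η ω i * ε ω j) := fun ω => by
    simp only [dotProduct, mulVec, Finset.mul_sum, dummy_proj_apply Z J hZ hpos]
    exact Finset.sum_congr rfl fun i _ => Finset.sum_congr rfl fun j _ => by ring
  simp only [hexp]
  rw [integral_finsetSum _ fun i _ => integrable_finsetSum _ fun j _ => (hint i j).const_mul _]
  simp only [integral_finsetSum _ fun j _ => (hint _ j).const_mul _, integral_const_mul]
  rw [sum_sum_eq_diag_add_fiberwise C _ fun i j hij => by rw [hcross i j hij, mul_zero]]
  simp only [if_true, mul_one]
end

section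
/- Let Z be an n×k judge dummy matrix with projection matrix P_Z, let two partitions ('clustering dimensions') of {1,…,n} be given with [G(i)] the set of indices sharing a cluster with i in at least one dimension, and let η, ε be random vectors in ℝⁿ with E|η_i ε_j| < ∞ for all i,j and E(η_i ε_j) = 0 whenever j ∉ [G(i)]. Then E(ηᵀ P_Z ε) = Σ_{i=1}^n (1/n_{J(i)}) E(η_i ε_i) + Σ_{i=1}^n Σ_{j ∈ [G^{(1)}(i)]^{(1)} \ {i}} (1/n_{J(i)}) 1{J(i)=J(j)} E(η_i ε_j) + Σ_{i=1}^n Σ_{j ∈ [G^{(2)}(i)]^{(2)} \ ([G^{(1)}(i)]^{(1)} ∪ {i})} (1/n_{J(i)}) 1{J(i)=J(j)} E(η_i ε_j); that is, clustering in a second dimension contributes an additional many-instrument bias term beyond the own-observation term and the first-dimension term. -/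
open Matrix Finset MeasureTheory

/-- The projection matrix onto the columns of a dummy matrix averages within groups. -/
theorem dummy_projection_apply {n k : ℕ} (Z : Matrix (Fin n) (Fin k) ℝ) (J : Fin n → Fin k)
    (hZ : ∀ i j, Z i j = if j = J i then 1 else 0) (nj : Fin k → ℕ)
    (hnj : ∀ j, nj j = (Finset.univ.filter (fun i => J i = j)).card)
    (hpos : ∀ j, 1 ≤ nj j) (i j : Fin n) :
    (Z * (Zᵀ * Z)⁻¹ * Zᵀ) i j = (1 / (nj (J i) : ℝ)) * (if J i = J j then 1 else 0) := by
  have hgram : Zᵀ * Z = Matrix.diagonal (fun a => (nj a : ℝ)) := by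
    ext a b
    simp only [Matrix.mul_apply, Matrix.transpose_apply, hZ, Matrix.diagonal_apply, hnj]
    by_cases hab : a = b
    · subst hab
      simp [← ite_and, eq_comm]
    · rw [if_neg hab]
      exact Finset.sum_eq_zero fun x _ => by
        by_cases ha : a = J x
        · simp [show b ≠ J x from fun hb => hab (ha.trans hb.symm)]
        · simp [ha]
  have hinv : (Zᵀ * Z)⁻¹ = Matrix.diagonal (fun a => 1 / (nj a : ℝ)) := by
    rw [hgram]
    refine Matrix.inv_eq_right_inv ?_
    rw [Matrix.diagonal_mul_diagonal, ← Matrix.diagonal_one]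
    congr 1
    funext a
    have : (nj a : ℝ) ≠ 0 := by
      have := hpos a
      positivity
    field_simp
  rw [hinv, Matrix.mul_apply]
  by_cases hij : J i = J j
  · simp [Matrix.mul_diagonal, hZ, hij]
  · simp [Matrix.mul_diagonal, hZ, hij, Ne.symm hij]

/-- The expectation of a quadratic form is the matrix-weighted sum of the cross-moments. -/
theorem integral_dotProduct_mulVec {Ω ι : Type*} [Fintype ι] [MeasurableSpace Ω]
    (μ : Measure Ω) (P : Matrix ι ι ℝ) (η ε : Ω → ι → ℝ)
    (hint : ∀ i j, Integrable (fun ω => η ω i * ε ω j) μ) :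
    (∫ ω, (η ω) ⬝ᵥ (P *ᵥ (ε ω)) ∂μ) = ∑ i, ∑ j, P i j * ∫ ω, η ω i * ε ω j ∂μ := by
  have hexpand : ∀ ω, (η ω) ⬝ᵥ (P *ᵥ (ε ω)) = ∑ i, ∑ j, P i j * (η ω i * ε ω j) := by
    intro ω
    simp only [dotProduct, Matrix.mulVec, Finset.mul_sum]
    exact Finset.sum_congr rfl fun i _ => Finset.sum_congr rfl fun j _ => by ring
  simp only [hexpand]
  refine (integral_finsetSum _ fun i _ =>
    integrable_finsetSum _ fun j _ => (hint i j).const_mul (P i j)).trans ?_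
  refine Finset.sum_congr rfl fun i _ => ?_
  refine (integral_finsetSum _ fun j _ => (hint i j).const_mul (P i j)).trans ?_
  exact Finset.sum_congr rfl fun j _ => integral_const_mul _ _

/-- With two clustering dimensions `C1, C2` and errors whose cross-moments
vanish outside `[G(i)] = [G¹(i)] ∪ [G²(i)]`, the bias term `E(ηᵀP_Zε)` decomposes into the
own-observation term, the first-dimension within-cluster term, and an additional
second-dimension term over `[G²(i)] \ ([G¹(i)] ∪ {i})`. -/
theorem stmt3 {Ω : Type*} [MeasurableSpace Ω] (μ : Measure Ω) [IsProbabilityMeasure μ]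
    (n k G1 G2 : ℕ) (Z : Matrix (Fin n) (Fin k) ℝ) (J : Fin n → Fin k)
    (hZ : ∀ i j, Z i j = if j = J i then 1 else 0)
    (nj : Fin k → ℕ)
    (hnj : ∀ j, nj j = (Finset.univ.filter (fun i => J i = j)).card)
    (hpos : ∀ j, 1 ≤ nj j)
    (C1 : Fin n → Fin G1) (hC1 : Function.Surjective C1)
    (C2 : Fin n → Fin G2) (hC2 : Function.Surjective C2)
    (η ε : Ω → Fin n → ℝ)
    (hint : ∀ i j, Integrable (fun ω => η ω i * ε ω j) μ)
    (hcross : ∀ i j, C1 i ≠ C1 j → C2 i ≠ C2 j → (∫ ω, η ω i * ε ω j ∂μ) = 0) :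
    (∫ ω, (η ω) ⬝ᵥ ((Z * (Zᵀ * Z)⁻¹ * Zᵀ) *ᵥ (ε ω)) ∂μ)
      = (∑ i, (1 / (nj (J i) : ℝ)) * ∫ ω, η ω i * ε ω i ∂μ)
        + (∑ i, ∑ j ∈ Finset.univ.filter (fun j => C1 j = C1 i ∧ j ≠ i),
            (1 / (nj (J i) : ℝ)) * (if J i = J j then 1 else 0)
              * ∫ ω, η ω i * ε ω j ∂μ)
        + ∑ i, ∑ j ∈ Finset.univ.filter
            (fun j => C2 j = C2 i ∧ ¬(C1 j = C1 i ∨ j = i)),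
            (1 / (nj (J i) : ℝ)) * (if J i = J j then 1 else 0)
              * ∫ ω, η ω i * ε ω j ∂μ := by
  rw [integral_dotProduct_mulVec μ _ η ε hint, ← Finset.sum_add_distrib,
    ← Finset.sum_add_distrib]
  refine Finset.sum_congr rfl fun i _ => ?_
  have hdiag : (1 / (nj (J i) : ℝ)) * ∫ ω, η ω i * ε ω i ∂μ
      = ∑ j, if j = i then (1 / (nj (J i) : ℝ)) * (if J i = J j then 1 else 0)
          * ∫ ω, η ω i * ε ω j ∂μ else 0 := by
    simp
  rw [hdiag, Finset.sum_filter, Finset.sum_filter, ← Finset.sum_add_distrib,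
    ← Finset.sum_add_distrib]
  refine Finset.sum_congr rfl fun j _ => ?_
  rw [dummy_projection_apply Z J hZ nj hnj hpos]
  by_cases hji : j = i
  · simp [hji]
  by_cases h1 : C1 j = C1 i
  · simp [hji, h1]
  by_cases h2 : C2 j = C2 i
  · simp [hji, h1, h2]
  · simp [hji, h1, h2, hcross i j (Ne.symm h1) (Ne.symm h2)]
end

section
/- Let Z be an n×k judge dummy matrix with projection matrix P_Z, and let a partition of {1,…,n} into clusters be given such that any two cases handled by the same judge lie in the same cluster (J(i) = J(j) implies that i and j share a cluster). Then the cluster-jackknifed projection matrix P̈_Z, obtained from P_Z by setting all within-cluster entries to zero, is the zero matrix. In particular, the cluster-jackknife IV estimator is undefined when one clusters at the judge level. -/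
open Matrix Finset

/-- The Gram matrix of a dummy matrix is diagonal. -/
theorem dummy_transpose_mul_self {ι κ : Type*} [Fintype ι] [DecidableEq κ]
    (Z : Matrix ι κ ℝ) (J : ι → κ) (hZ : ∀ i j, Z i j = if j = J i then 1 else 0) :
    Zᵀ * Z = Matrix.diagonal fun j => ∑ i, Z i j := by
  ext a b
  rw [Matrix.mul_apply, Matrix.diagonal_apply]
  split_ifs with h
  · subst h
    exact Finset.sum_congr rfl fun i _ => by simp [hZ]
  · refine Finset.sum_eq_zero fun i _ => ?_
    rw [Matrix.transpose_apply, hZ, hZ]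
    grind

/-- The projection matrix of a dummy matrix vanishes between different categories. -/
theorem dummy_projection_apply_of_ne {ι κ : Type*} [Fintype ι] [Fintype κ] [DecidableEq κ]
    (Z : Matrix ι κ ℝ) (J : ι → κ) (hZ : ∀ i j, Z i j = if j = J i then 1 else 0)
    {i j : ι} (hij : J i ≠ J j) : (Z * (Zᵀ * Z)⁻¹ * Zᵀ) i j = 0 := by
  rw [dummy_transpose_mul_self Z J hZ, Matrix.inv_diagonal, Matrix.mul_apply]
  refine Finset.sum_eq_zero fun a _ => ?_
  rw [Matrix.mul_diagonal, Matrix.transpose_apply, hZ, hZ]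
  grind

/-- If the clustering is coarser than the judge assignment (cases with the
same judge share a cluster), then the cluster-jackknifed projection matrix `P̈_Z`
(within-cluster entries of `P_Z` set to zero) is the zero matrix. -/
theorem stmt7 (n k G : ℕ) (Z : Matrix (Fin n) (Fin k) ℝ) (J : Fin n → Fin k)
    (hZ : ∀ i j, Z i j = if j = J i then 1 else 0)
    (nj : Fin k → ℕ)
    (hnj : ∀ j, nj j = (Finset.univ.filter (fun i => J i = j)).card)
    (hpos : ∀ j, 1 ≤ nj j)
    (C : Fin n → Fin G) (hC : Function.Surjective C)
    (hJC : ∀ i j, J i = J j → C i = C j) :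
    (Matrix.of fun i j =>
        if C i = C j then 0 else (Z * (Zᵀ * Z)⁻¹ * Zᵀ) i j)
      = (0 : Matrix (Fin n) (Fin n) ℝ) := by
  ext i j
  rw [Matrix.of_apply, Matrix.zero_apply]
  split_ifs with h
  · rfl
  · exact dummy_projection_apply_of_ne Z J hZ fun hJ => h (hJC i j hJ)
end

section
/- Let W ∈ ℝ^{n×l} and Z ∈ ℝ^{n×k} be matrices such that the block matrix (W Z) has full column rank and Zᵀ M_W Z is invertible, where M_W = I − P_W. Let P_{M_W Z} = M_W Z (Zᵀ M_W Z)⁻¹ Zᵀ M_W and let M_{W,Z} = I − P_{(W Z)} be the annihilator of the columns of W and Z jointly. Then: (i) P_{M_W Z} W = 0; (ii) M_{W,Z} Z = 0 and M_{W,Z} W = 0; (iii) P_{M_W Z} M_{W,Z} = 0 and M_{W,Z} P_{M_W Z} = 0; and consequently (iv) for every n×n matrix H, Zᵀ (P_{M_W Z} − M_{W,Z} H M_{W,Z}) Z = Zᵀ M_W Z and (P_{M_W Z} − M_{W,Z} H M_{W,Z}) W = 0. -/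
open Matrix Finset

namespace Matrix

variable {m n : Type*} [Fintype m] [Fintype n] [DecidableEq n]

theorem isUnit_det_transpose_mul_self {A : Matrix m n ℝ} (hA : LinearIndependent ℝ A.col) :
    IsUnit (Aᵀ * A).det := by
  have h : (Aᴴ * A).PosDef :=
    PosDef.conjTranspose_mul_self A (mulVec_injective_iff.mpr hA)
  rw [conjTranspose_eq_transpose_of_trivial] at h
  exact h.det_pos.ne'.isUnit

theorem one_sub_proj_mul_self [DecidableEq m] {A : Matrix m n ℝ} (hA : IsUnit (Aᵀ * A).det) :
    (1 - A * (Aᵀ * A)⁻¹ * Aᵀ) * A = 0 := by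
  rw [Matrix.sub_mul, Matrix.one_mul, Matrix.mul_assoc, Matrix.mul_assoc, nonsing_inv_mul _ hA,
    Matrix.mul_one, sub_self]

theorem transpose_one_sub_proj [DecidableEq m] (A : Matrix m n ℝ) :
    (1 - A * (Aᵀ * A)⁻¹ * Aᵀ)ᵀ = 1 - A * (Aᵀ * A)⁻¹ * Aᵀ := by
  simp [transpose_mul, transpose_nonsing_inv, Matrix.mul_assoc]

end Matrix

/-- With `(W Z)` of full column rank and `ZᵀM_WZ` invertible:
(i) `P_{M_WZ} W = 0`; (ii) `M_{W,Z} Z = 0` and `M_{W,Z} W = 0`;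
(iii) `P_{M_WZ} M_{W,Z} = 0 = M_{W,Z} P_{M_WZ}`; hence (iv) for every `H`,
`Zᵀ(P_{M_WZ} − M_{W,Z}HM_{W,Z})Z = ZᵀM_WZ` and `(P_{M_WZ} − M_{W,Z}HM_{W,Z})W = 0`. -/
theorem stmt10 (n l k : ℕ)
    (W : Matrix (Fin n) (Fin l) ℝ) (Z : Matrix (Fin n) (Fin k) ℝ)
    (WZ : Matrix (Fin n) (Fin l ⊕ Fin k) ℝ)
    (hWZ : ∀ i, WZ i = Sum.elim (W i) (Z i))
    (hrank : LinearIndependent ℝ (fun j : Fin l ⊕ Fin k => fun i : Fin n => WZ i j))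
    (MW : Matrix (Fin n) (Fin n) ℝ) (hMW : MW = 1 - W * (Wᵀ * W)⁻¹ * Wᵀ)
    (hZMZ : IsUnit (Zᵀ * MW * Z).det)
    (PMZ : Matrix (Fin n) (Fin n) ℝ)
    (hPMZ : PMZ = MW * Z * (Zᵀ * MW * Z)⁻¹ * Zᵀ * MW)
    (MWZ : Matrix (Fin n) (Fin n) ℝ)
    (hMWZ : MWZ = 1 - WZ * (WZᵀ * WZ)⁻¹ * WZᵀ) :
    PMZ * W = 0 ∧
    (MWZ * Z = 0 ∧ MWZ * W = 0) ∧
    (PMZ * MWZ = 0 ∧ MWZ * PMZ = 0) ∧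
    (∀ H : Matrix (Fin n) (Fin n) ℝ,
      Zᵀ * (PMZ - MWZ * H * MWZ) * Z = Zᵀ * MW * Z ∧
      (PMZ - MWZ * H * MWZ) * W = 0) := by
  have hcols : WZ = fromCols W Z := by
    ext i j
    rw [hWZ]
    rfl
  have hW : LinearIndependent ℝ W.col := by
    convert hrank.comp Sum.inl Sum.inl_injective using 1
    funext j i
    simp [hWZ]
  have hMW_W : MW * W = 0 := by
    rw [hMW]
    exact one_sub_proj_mul_self (isUnit_det_transpose_mul_self hW)
  have hMWZ_WZ : MWZ * WZ = 0 := by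
    rw [hMWZ]
    exact one_sub_proj_mul_self (isUnit_det_transpose_mul_self hrank)
  rw [hcols, mul_fromCols, ← fromCols_zero, fromCols_inj.eq_iff] at hMWZ_WZ
  obtain ⟨hMWZ_W, hMWZ_Z⟩ := hMWZ_WZ
  have hMWt : MWᵀ = MW := by rw [hMW, transpose_one_sub_proj]
  have hMWZt : MWZᵀ = MWZ := by rw [hMWZ, transpose_one_sub_proj]
  have hWt_MWZ : Wᵀ * MWZ = 0 := by
    rw [← hMWZt, ← transpose_mul, hMWZ_W, transpose_zero]
  have hZt_MWZ : Zᵀ * MWZ = 0 := by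
    rw [← hMWZt, ← transpose_mul, hMWZ_Z, transpose_zero]
  have hMW_MWZ : MW * MWZ = MWZ := by
    rw [hMW, Matrix.sub_mul, Matrix.mul_assoc, hWt_MWZ, Matrix.mul_zero, Matrix.one_mul, sub_zero]
  have hMWZ_MW : MWZ * MW = MWZ := by
    simpa [transpose_mul, hMWt, hMWZt] using congrArg transpose hMW_MWZ
  have hPMZ_W : PMZ * W = 0 := by
    rw [hPMZ, Matrix.mul_assoc, hMW_W, Matrix.mul_zero]
  have hPMZ_MWZ : PMZ * MWZ = 0 := by
    rw [hPMZ, Matrix.mul_assoc, hMW_MWZ, Matrix.mul_assoc, hZt_MWZ, Matrix.mul_zero]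
  have hMWZ_PMZ : MWZ * PMZ = 0 := by
    simp only [hPMZ, ← Matrix.mul_assoc, hMWZ_MW, hMWZ_Z, Matrix.zero_mul]
  have hZPZ : Zᵀ * PMZ * Z = Zᵀ * MW * Z := by
    calc Zᵀ * PMZ * Z
        = Zᵀ * MW * Z * (Zᵀ * MW * Z)⁻¹ * (Zᵀ * MW * Z) := by
          simp only [hPMZ, Matrix.mul_assoc]
      _ = Zᵀ * MW * Z := by rw [mul_nonsing_inv _ hZMZ, Matrix.one_mul]
  refine ⟨hPMZ_W, ⟨hMWZ_Z, hMWZ_W⟩, ⟨hPMZ_MWZ, hMWZ_PMZ⟩, fun H => ⟨?_, ?_⟩⟩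
  · rw [Matrix.mul_sub, Matrix.sub_mul, hZPZ, Matrix.mul_assoc Zᵀ (MWZ * H * MWZ),
      Matrix.mul_assoc (MWZ * H), hMWZ_Z, Matrix.mul_zero, Matrix.mul_zero, sub_zero]
  · rw [Matrix.sub_mul, hPMZ_W, Matrix.mul_assoc, hMWZ_W, Matrix.mul_zero, sub_zero]
end

section
/- Let a partition of {1,…,n} into clusters [g], g = 1,…,G, be given, let W be the corresponding cluster-dummy matrix with M_W = I − P_W, and let η, ε be random vectors in ℝⁿ with E|η_i ε_j| < ∞ for all i,j, Ξ = E(η εᵀ), and Ξ_{ij} = 0 whenever i and j lie in different clusters. Let P̃ be a random n×n matrix, independent of (η, ε), with E|P̃_{ij}| < ∞ and such that for each cluster g there is a constant μ_g with E(P̃_{ij}) = μ_g for all i, j ∈ [g], and assume all products η_i P̃_{kl} ε_j are integrable. Then E(ηᵀ M_W P̃ M_W ε) = 0; i.e. when the projection weights are independent of the errors and have constant within-cluster expectation, including cluster fixed effects removes the entire many-instrument bias even under general within-cluster error dependence. -/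
open Matrix Finset MeasureTheory ProbabilityTheory

namespace ClusterDummy

variable {ι κ : Type*} [Fintype ι] [DecidableEq ι] [Fintype κ] [DecidableEq κ]
  {C : ι → κ} {W : Matrix ι κ ℝ}

/-- The matrix `I - P_W` of the orthogonal projection onto the complement of the column space of
`W`. -/
noncomputable def residualMaker (W : Matrix ι κ ℝ) : Matrix ι ι ℝ :=
  1 - W * (Wᵀ * W)⁻¹ * Wᵀ

/-- Entries of the residual maker `I - P_W` of a cluster-dummy matrix. -/
theorem residualMaker_apply (hC : Function.Surjective C)
    (hW : ∀ i g, W i g = if C i = g then 1 else 0) (i k : ι) :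
    residualMaker W i k =
      (if i = k then 1 else 0) - if C i = C k then (#{l | C i = C l} : ℝ)⁻¹ else 0 := by
  have hgram : Wᵀ * W = diagonal fun g => (#{l | g = C l} : ℝ) := by
    ext g h
    simp only [mul_apply, transpose_apply, hW, diagonal_apply]
    split_ifs with hgh
    · subst hgh
      simp [← ite_and, eq_comm]
    · refine Finset.sum_eq_zero fun l _ => ?_
      by_cases hl : C l = g
      · simp [hl, hgh]
      · simp [hl]
  have hcard (g : κ) : (#{l | g = C l} : ℝ) ≠ 0 := by
    obtain ⟨l, rfl⟩ := hC g
    exact Nat.cast_ne_zero.mpr (Finset.card_ne_zero_of_mem (by simp : l ∈ _))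
  have hinv : (Wᵀ * W)⁻¹ = diagonal fun g => (#{l | g = C l} : ℝ)⁻¹ := by
    refine inv_eq_right_inv ?_
    rw [hgram, diagonal_mul_diagonal, ← diagonal_one]
    congr 1
    ext g
    exact mul_inv_cancel₀ (hcard g)
  rw [residualMaker, hinv, Matrix.sub_apply, one_apply, mul_apply]
  simp only [mul_diagonal, transpose_apply, hW]
  by_cases hik : C i = C k <;> simp [hik, eq_comm]

theorem residualMaker_apply_eq_zero (hC : Function.Surjective C)
    (hW : ∀ i g, W i g = if C i = g then 1 else 0) {i k : ι} (hik : C i ≠ C k) :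
    residualMaker W i k = 0 := by
  have hne : i ≠ k := fun h => hik (congrArg C h)
  simp [residualMaker_apply hC hW, hik, hne]

theorem sum_residualMaker_apply (hC : Function.Surjective C)
    (hW : ∀ i g, W i g = if C i = g then 1 else 0) (i : ι) :
    ∑ k, residualMaker W i k = 0 := by
  have hcard : (#{l | C i = C l} : ℝ) ≠ 0 :=
    Nat.cast_ne_zero.mpr (Finset.card_ne_zero_of_mem (by simp : i ∈ _))
  simp only [residualMaker_apply hC hW, Finset.sum_sub_distrib, Finset.sum_ite_eq,
    Finset.mem_univ, if_true]
  rw [← Finset.sum_filter, Finset.sum_const, nsmul_eq_mul, mul_inv_cancel₀ hcard, sub_self]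

/-- A matrix that is constant on each diagonal cluster block is annihilated on these blocks by
two-sided multiplication with the residual maker. -/
theorem sum_residualMaker_mul_mul (hC : Function.Surjective C)
    (hW : ∀ i g, W i g = if C i = g then 1 else 0) {A : Matrix ι ι ℝ} {c : κ → ℝ}
    (hA : ∀ k l, C k = C l → A k l = c (C k)) {i j : ι} (hij : C i = C j) :
    ∑ k, ∑ l, residualMaker W i k * A k l * residualMaker W l j = 0 := by
  have hterm (k l : ι) :
      residualMaker W i k * A k l * residualMaker W l j =
        residualMaker W i k * (c (C i) * residualMaker W l j) := by
    by_cases hik : C i = C k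
    · by_cases hlj : C l = C j
      · rw [hA k l (by rw [← hik, hlj, hij]), hik, mul_assoc]
      · simp [residualMaker_apply_eq_zero hC hW hlj]
    · simp [residualMaker_apply_eq_zero hC hW hik]
  simp_rw [hterm]
  rw [← Finset.sum_mul_sum, sum_residualMaker_apply hC hW, zero_mul]

end ClusterDummy

/-- Expansion of the bilinear form of `A * P * B` into monomials. -/
theorem dotProduct_mul_mul_mulVec {ι : Type*} [Fintype ι] (A P B : Matrix ι ι ℝ) (u v : ι → ℝ) :
    u ⬝ᵥ ((A * P * B) *ᵥ v) =
      ∑ i, ∑ j, ∑ k, ∑ l, A i k * B l j * (u i * P k l * v j) := by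
  simp only [dotProduct, mulVec, mul_apply, Finset.mul_sum, Finset.sum_mul]
  refine Finset.sum_congr rfl fun i _ => Finset.sum_congr rfl fun j _ => ?_
  rw [Finset.sum_comm]
  exact Finset.sum_congr rfl fun k _ => Finset.sum_congr rfl fun l _ => by ring

/-- If the random projection weights `P̃` are independent of `(η, ε)` and
have constant within-cluster expectation (`E(P̃_{ij}) = μ_g` for all `i, j ∈ [g]`), and
the error covariance `Ξ = E(ηεᵀ)` is block-diagonal with respect to the clustering, then
`E(ηᵀ M_W P̃ M_W ε) = 0`: cluster fixed effects remove the entire many-instrument bias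
even under general within-cluster dependence. -/
theorem stmt15 {Ω : Type*} [MeasurableSpace Ω] (μ : Measure Ω) [IsProbabilityMeasure μ]
    (n G : ℕ) (C : Fin n → Fin G) (hC : Function.Surjective C)
    (W : Matrix (Fin n) (Fin G) ℝ)
    (hW : ∀ i g, W i g = if C i = g then 1 else 0)
    (MW : Matrix (Fin n) (Fin n) ℝ) (hMW : MW = 1 - W * (Wᵀ * W)⁻¹ * Wᵀ)
    (η ε : Ω → Fin n → ℝ) (hη : Measurable η) (hε : Measurable ε)
    (hint : ∀ i j, Integrable (fun ω => η ω i * ε ω j) μ)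
    (Ξ : Matrix (Fin n) (Fin n) ℝ)
    (hΞ : ∀ i j, Ξ i j = ∫ ω, η ω i * ε ω j ∂μ)
    (hclus : ∀ i j, C i ≠ C j → Ξ i j = 0)
    (Pt : Ω → Fin n → Fin n → ℝ) (hPt : Measurable Pt)
    (hPtint : ∀ i j, Integrable (fun ω => Pt ω i j) μ)
    (hprodint : ∀ i j a b, Integrable (fun ω => η ω i * Pt ω a b * ε ω j) μ)
    (hindep : IndepFun Pt (fun ω => (η ω, ε ω)) μ)
    (μg : Fin G → ℝ)
    (hmean : ∀ i j, C i = C j → (∫ ω, Pt ω i j ∂μ) = μg (C i)) :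
    (∫ ω, (η ω) ⬝ᵥ ((MW * Matrix.of (Pt ω) * MW) *ᵥ (ε ω)) ∂μ) = 0 := by
  have hfac (i j k l : Fin n) :
      ∫ ω, η ω i * Pt ω k l * ε ω j ∂μ = (∫ ω, Pt ω k l ∂μ) * Ξ i j := by
    have hind : IndepFun (fun ω => Pt ω k l) (fun ω => η ω i * ε ω j) μ :=
      hindep.comp (φ := fun p : Fin n → Fin n → ℝ => p k l)
        (ψ := fun q : (Fin n → ℝ) × (Fin n → ℝ) => q.1 i * q.2 j) (by fun_prop) (by fun_prop)
    rw [hΞ, ← hind.integral_fun_mul_eq_mul_integral (hPtint k l).aestronglyMeasurable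
      (hint i j).aestronglyMeasurable]
    exact integral_congr_ae (.of_forall fun ω => by ring)
  have hterm (i j k l : Fin n) :
      Integrable (fun ω => MW i k * MW l j * (η ω i * Pt ω k l * ε ω j)) μ :=
    (hprodint i j k l).const_mul _
  simp only [dotProduct_mul_mul_mulVec, of_apply]
  rw [integral_finsetSum _ fun i _ => integrable_finsetSum _ fun j _ => integrable_finsetSum _
    fun k _ => integrable_finsetSum _ fun l _ => hterm i j k l]
  refine Finset.sum_eq_zero fun i _ => ?_
  rw [integral_finsetSum _ fun j _ => integrable_finsetSum _
    fun k _ => integrable_finsetSum _ fun l _ => hterm i j k l]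
  refine Finset.sum_eq_zero fun j _ => ?_
  rw [integral_finsetSum _ fun k _ => integrable_finsetSum _ fun l _ => hterm i j k l]
  simp_rw [integral_finsetSum Finset.univ fun l _ => hterm i j _ l, integral_const_mul, hfac]
  by_cases hij : C i = C j
  · have hblock := ClusterDummy.sum_residualMaker_mul_mul hC hW
      (A := Matrix.of fun k l => ∫ ω, Pt ω k l ∂μ) hmean hij
    rw [ClusterDummy.residualMaker, ← hMW] at hblock
    rw [← zero_mul (Ξ i j), ← hblock]
    simp only [Finset.sum_mul, of_apply]
    exact Finset.sum_congr rfl fun k _ => Finset.sum_congr rfl fun l _ => by ring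
  · simp [hclus i j hij]
end
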